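/- arXiv:1506.01931 — 7 statements merged into one kernel-verified Lean document; each statement's English description precedes it below -/
import Mathlib

section
/- Let n ≥ 1 and let A and B be invertible symmetric (n+1)×(n+1) matrices over ℂ such that the polynomial p(t) = det(A + t•B) has n+1 pairwise distinct complex roots t₀, …, tₙ. Then there exists an invertible complex (n+1)×(n+1) matrix G such that Gᵀ•B•G is the identity matrix and Gᵀ•A•G is the diagonal matrix with diagonal entries −t₀, …, −tₙ (in particular A and B are simultaneously diagonalizable by congruence). -/
open Matrix

/-- A matrix commuting with a diagonal matrix with distinct entries is diagonal. -/
theorem Matrix.eq_diagonal_diag_of_commute {ι K : Type*} [Fintype ι] [DecidableEq ι] [Field K]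
    {M : Matrix ι ι K} {t : ι → K} (ht : Function.Injective t)
    (h : M * diagonal t = diagonal t * M) : M = diagonal M.diag := by
  ext i j
  rcases eq_or_ne i j with rfl | hij
  · simp
  · have hM := congrFun (congrFun h i) j
    rw [mul_diagonal, diagonal_mul] at hM
    have hz : (t j - t i) * M i j = 0 := by linear_combination hM
    rw [diagonal_apply_ne _ hij]
    exact (mul_eq_zero.mp hz).resolve_left (sub_ne_zero.mpr (ht.ne hij.symm))

/-- If `det (A + x • B)` vanishes at the distinct points `t i`, with `B` invertible, then kernel
vectors of the matrices `A + t i • B` are the columns of an invertible matrix. -/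
theorem Matrix.exists_isUnit_mul_eq_neg_mul_diagonal {ι K : Type*} [Fintype ι] [DecidableEq ι]
    [Field K] {A B : Matrix ι ι K} (hB : IsUnit B) {t : ι → K} (ht : Function.Injective t)
    (hroots : ∀ i, (A + t i • B).det = 0) :
    ∃ P : Matrix ι ι K, IsUnit P ∧ A * P = -(B * P * diagonal t) := by
  choose v hv0 hv using fun i => exists_mulVec_eq_zero_iff.mpr (hroots i)
  have hAv (i : ι) : A *ᵥ v i = -(t i • B *ᵥ v i) := by
    have h := hv i
    rw [add_mulVec, smul_mulVec] at h
    exact eq_neg_of_add_eq_zero_left h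
  have hBdet : IsUnit B.det := (isUnit_iff_isUnit_det B).mp hB
  have hli : LinearIndependent K v := by
    refine Module.End.eigenvectors_linearIndependent' (toLin' (B⁻¹ * A)) (fun i => -t i)
      (neg_injective.comp ht) v fun i => ?_
    rw [Module.End.hasEigenvector_iff, Module.End.mem_eigenspace_iff]
    refine ⟨?_, hv0 i⟩
    rw [toLin'_apply, ← mulVec_mulVec, hAv, mulVec_neg, mulVec_smul, mulVec_mulVec,
      nonsing_inv_mul B hBdet, one_mulVec, neg_smul]
  refine ⟨(of v)ᵀ, linearIndependent_cols_iff_isUnit.mp hli, ?_⟩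
  ext i j
  have h := congrFun (hAv j) i
  rw [neg_apply, mul_diagonal, mul_comm]
  exact h

/-- An invertible diagonal matrix over an algebraically closed field is congruent to `1` by an
invertible diagonal matrix. -/
theorem Matrix.exists_diagonal_mul_diagonal_mul_diagonal_eq_one {ι K : Type*} [Fintype ι]
    [DecidableEq ι] [Field K] [IsAlgClosed K] {d : ι → K} (hd : IsUnit (diagonal d)) :
    ∃ e : ι → K, IsUnit (diagonal e) ∧ diagonal e * diagonal d * diagonal e = 1 := by
  have hd0 (i : ι) : d i ≠ 0 := (Pi.isUnit_iff.mp (isUnit_diagonal.mp hd) i).ne_zero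
  choose e he using fun i => IsAlgClosed.exists_pow_nat_eq (d i)⁻¹ two_pos
  have he0 (i : ι) : e i ≠ 0 := fun h =>
    inv_ne_zero (hd0 i) (by rw [← he i, h, zero_pow two_ne_zero])
  refine ⟨e, isUnit_diagonal.mpr (Pi.isUnit_iff.mpr fun i => (he0 i).isUnit), ?_⟩
  rw [diagonal_mul_diagonal, diagonal_mul_diagonal, ← diagonal_one]
  refine congrArg diagonal (funext fun i => ?_)
  calc e i * d i * e i = e i ^ 2 * d i := by ring
    _ = 1 := by rw [he, inv_mul_cancel₀ (hd0 i)]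

/-- Two invertible symmetric complex matrices whose pencil determinant
polynomial `det (A + t • B)` has `n+1` pairwise distinct roots `t₀, …, tₙ` are
simultaneously diagonalizable by congruence: there is an invertible `G` with
`Gᵀ * B * G = 1` and `Gᵀ * A * G = diagonal (fun i => - t i)`. -/
theorem simultaneous_diagonalization_by_congruence
    (n : ℕ) (hn : 1 ≤ n)
    (A B : Matrix (Fin (n + 1)) (Fin (n + 1)) ℂ)
    (hA : IsUnit A) (hB : IsUnit B)
    (hAsymm : Aᵀ = A) (hBsymm : Bᵀ = B)
    (t : Fin (n + 1) → ℂ) (htinj : Function.Injective t)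
    (hroots : ∀ i, (A + t i • B).det = 0) :
    ∃ G : Matrix (Fin (n + 1)) (Fin (n + 1)) ℂ, IsUnit G ∧
      Gᵀ * B * G = 1 ∧ Gᵀ * A * G = Matrix.diagonal (fun i => - t i) := by
  obtain ⟨P, hP, hAP⟩ := exists_isUnit_mul_eq_neg_mul_diagonal hB htinj hroots
  set M := Pᵀ * B * P with hM
  have hMsymm : Mᵀ = M := by simp [hM, hBsymm, Matrix.mul_assoc]
  have hPAP : Pᵀ * A * P = -(M * diagonal t) := by
    rw [Matrix.mul_assoc, hAP, Matrix.mul_neg, hM]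
    simp only [Matrix.mul_assoc]
  have hcomm : M * diagonal t = diagonal t * M := by
    have h : (Pᵀ * A * P)ᵀ = Pᵀ * A * P := by simp [hAsymm, Matrix.mul_assoc]
    rw [hPAP, transpose_neg, transpose_mul, diagonal_transpose, hMsymm] at h
    exact (neg_injective h).symm
  have hMunit : IsUnit M := (((isUnit_transpose P).mpr hP).mul hB).mul hP
  have hMdiag := eq_diagonal_diag_of_commute htinj hcomm
  rw [hMdiag] at hMunit
  obtain ⟨e, he, heM⟩ := exists_diagonal_mul_diagonal_mul_diagonal_eq_one hMunit
  rw [← hMdiag] at heM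
  have hcongr (C : Matrix (Fin (n + 1)) (Fin (n + 1)) ℂ) :
      (P * diagonal e)ᵀ * C * (P * diagonal e) = diagonal e * (Pᵀ * C * P) * diagonal e := by
    simp only [transpose_mul, diagonal_transpose, Matrix.mul_assoc]
  refine ⟨P * diagonal e, hP.mul he, (hcongr B).trans heM, ?_⟩
  have hte : diagonal t * diagonal e = diagonal e * diagonal t := by
    simp only [diagonal_mul_diagonal, mul_comm]
  calc (P * diagonal e)ᵀ * A * (P * diagonal e)
      = -(diagonal e * M * (diagonal t * diagonal e)) := by
        rw [hcongr, hPAP]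
        simp only [Matrix.mul_neg, Matrix.neg_mul, Matrix.mul_assoc]
    _ = -diagonal t := by rw [hte, ← Matrix.mul_assoc, heM, Matrix.one_mul]
    _ = diagonal (fun i => - t i) := diagonal_neg t
end

section
/- Let A be a symmetric (n+1)×(n+1) matrix over ℂ having n+1 pairwise distinct eigenvalues. Then there exists a complex orthogonal matrix O, i.e. an (n+1)×(n+1) complex matrix with Oᵀ•O equal to the identity, such that Oᵀ•A•O is diagonal. -/
open Matrix

/-- Eigenvectors of a symmetric matrix for distinct eigenvalues are orthogonal with respect to
the standard bilinear form. -/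
theorem Matrix.IsSymm.dotProduct_eq_zero_of_mulVec_eq_smul {ι K : Type*} [Fintype ι] [Field K]
    {A : Matrix ι ι K} (hA : A.IsSymm) {a b : K} (hab : a ≠ b) {v w : ι → K}
    (hv : A *ᵥ v = a • v) (hw : A *ᵥ w = b • w) : v ⬝ᵥ w = 0 := by
  have h : a * (v ⬝ᵥ w) = b * (v ⬝ᵥ w) := by
    rw [← smul_eq_mul, ← smul_eq_mul, ← smul_dotProduct, ← dotProduct_smul, ← hv, ← hw,
      dotProduct_mulVec, ← mulVec_transpose, hA.eq]
  by_contra hne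
  exact hab (mul_right_cancel₀ hne h)

/-- A complex symmetric `(n+1)×(n+1)` matrix with `n+1` pairwise distinct
eigenvalues is diagonalizable by a complex orthogonal matrix `O` (`Oᵀ * O = 1`). -/
theorem symmetric_distinct_eigenvalues_orthogonally_diagonalizable
    (n : ℕ) (A : Matrix (Fin (n + 1)) (Fin (n + 1)) ℂ)
    (hAsymm : Aᵀ = A)
    (μ : Fin (n + 1) → ℂ) (hμinj : Function.Injective μ)
    (heig : ∀ i, ∃ v : Fin (n + 1) → ℂ, v ≠ 0 ∧ A *ᵥ v = μ i • v) :
    ∃ O : Matrix (Fin (n + 1)) (Fin (n + 1)) ℂ,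
      Oᵀ * O = 1 ∧ (Oᵀ * A * O).IsDiag := by
  choose v hv0 hv using heig
  have horth : ∀ i j, i ≠ j → v i ⬝ᵥ v j = 0 := fun i j hij =>
    Matrix.IsSymm.dotProduct_eq_zero_of_mulVec_eq_smul hAsymm (hμinj.ne hij) (hv i) (hv j)
  have hli : LinearIndependent ℂ v :=
    Module.End.eigenvectors_linearIndependent' (Matrix.toLin' A) μ hμinj v fun i =>
      ⟨Module.End.mem_eigenspace_iff.2 (by simpa using hv i), hv0 i⟩
  have hgram : of v * (of v)ᵀ = diagonal fun i => v i ⬝ᵥ v i := by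
    ext i j
    rcases eq_or_ne i j with rfl | hij
    · simp [mul_apply, dotProduct]
    · rw [diagonal_apply_ne _ hij]
      exact horth i j hij
  have hdet : (of v).det ≠ 0 :=
    ((isUnit_iff_isUnit_det _).1 (linearIndependent_rows_iff_isUnit.1 hli)).ne_zero
  have hself : ∀ i, v i ⬝ᵥ v i ≠ 0 := by
    have h := congrArg det hgram
    rw [det_mul, det_transpose, det_diagonal] at h
    have hprod : ∏ i, v i ⬝ᵥ v i ≠ 0 := h ▸ mul_ne_zero hdet hdet
    exact fun i => Finset.prod_ne_zero_iff.1 hprod i (Finset.mem_univ i)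
  choose c hc using fun i => IsAlgClosed.exists_pow_nat_eq (v i ⬝ᵥ v i) two_pos
  have hc0 : ∀ i, c i ≠ 0 := fun i h => hself i (by rw [← hc i, h]; simp)
  let w : Fin (n + 1) → Fin (n + 1) → ℂ := fun i => (c i)⁻¹ • v i
  have hw : ∀ i j, w i ⬝ᵥ w j = (1 : Matrix (Fin (n + 1)) (Fin (n + 1)) ℂ) i j := by
    intro i j
    simp only [w, smul_dotProduct, dotProduct_smul, smul_eq_mul]
    rcases eq_or_ne i j with rfl | hij
    · rw [← hc i, one_apply_eq]
      field_simp [hc0 i]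
    · simp [horth i j hij, one_apply_ne hij]
  refine ⟨(of w)ᵀ, Matrix.ext hw, fun i j hij => ?_⟩
  have hAw : A *ᵥ w j = μ j • w j := by
    simp only [w, mulVec_smul, hv, smul_comm (μ j)]
  rw [Matrix.mul_assoc]
  change w i ⬝ᵥ (A *ᵥ w j) = 0
  rw [hAw, dotProduct_smul, hw, one_apply_ne hij, smul_zero]
end

section
/- Let n ≥ 1 and let A and B be invertible symmetric (n+1)×(n+1) matrices over ℂ. The following are equivalent: (1) for every nonzero x ∈ ℂⁿ⁺¹ with xᵀ•A•x = 0 and xᵀ•B•x = 0, the vectors A•x and B•x are linearly independent over ℂ (i.e. the two quadric hypersurfaces {xᵀAx = 0} and {xᵀBx = 0} in ℙⁿ intersect transversally, that is, with normal crossings); (2) the polynomial t ↦ det(A + t•B), which has degree n+1, has n+1 pairwise distinct complex roots (i.e. the pencil generated by the two quadrics contains exactly n+1 distinct singular quadrics). -/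
open Matrix

namespace Module.End

variable {K V : Type*} [Field K] [AddCommGroup V] [Module K V]

/-- Eigenvectors of a self-adjoint endomorphism for distinct eigenvalues are orthogonal. -/
theorem eq_zero_of_selfAdjoint_of_ne {b : LinearMap.BilinForm K V} {f : End K V}
    (hf : ∀ x y, b (f x) y = b x (f y)) {μ ν : K} (hne : μ ≠ ν) {x y : V}
    (hx : f x = μ • x) (hy : f y = ν • y) : b x y = 0 := by
  have h := hf x y
  rw [hx, hy] at h
  simp only [map_smul, LinearMap.smul_apply, smul_eq_mul] at h
  exact (mul_eq_zero.mp (by rw [sub_mul, h, sub_self] : (μ - ν) * b x y = 0)).resolve_left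
    (sub_ne_zero.mpr hne)

/-- If a self-adjoint endomorphism has as many distinct eigenvalues as the dimension, then its
eigenvectors are anisotropic. -/
theorem HasEigenvector.apply_self_ne_zero_of_injective [FiniteDimensional K V]
    {b : LinearMap.BilinForm K V} (hb : ∀ x, b x = 0 → x = 0) {f : End K V}
    (hf : ∀ x y, b (f x) y = b x (f y)) {ι : Type*} [Fintype ι]
    (hι : Fintype.card ι = Module.finrank K V) {t : ι → K} (ht : Function.Injective t)
    (hev : ∀ i, f.HasEigenvalue (t i)) {μ : K} {x : V} (hx : f.HasEigenvector μ x) :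
    b x x ≠ 0 := by
  intro h0
  have hv : ∀ i, ∃ v, f.HasEigenvector (t i) v ∧ b x v = 0 := by
    intro i
    by_cases hi : t i = μ
    · exact ⟨x, hi ▸ hx, h0⟩
    · obtain ⟨v, hv⟩ := (hev i).exists_hasEigenvector
      exact ⟨v, hv, eq_zero_of_selfAdjoint_of_ne hf (Ne.symm hi) hx.apply_eq_smul
        hv.apply_eq_smul⟩
  choose v hv hxv using hv
  have hli : LinearIndependent K v := eigenvectors_linearIndependent' f t ht v hv
  have hspan := hli.span_eq_top_of_card_eq_finrank' hι
  refine hx.2 (hb x (LinearMap.ext_on_range hspan fun i ↦ ?_))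
  simpa using hxv i

/-- If every eigenvector of a self-adjoint endomorphism is anisotropic, then there are as many
distinct eigenvalues as the dimension. -/
theorem finrank_le_card_eigenvalues_of_apply_self_ne_zero [IsAlgClosed K] [FiniteDimensional K V]
    {b : LinearMap.BilinForm K V} (hb : ∀ x y, b x y = b y x) {f : End K V}
    (hf : ∀ x y, b (f x) y = b x (f y))
    (h : ∀ μ x, f.HasEigenvector μ x → b x x ≠ 0) :
    Module.finrank K V ≤ Fintype.card f.Eigenvalues := by
  have eq_zero : ∀ μ x, f x = μ • x → b x x = 0 → x = 0 := fun μ x hx h0 ↦ by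
    by_contra hne
    exact h μ x ⟨mem_eigenspace_iff.mpr hx, hne⟩ h0
  have hf' : ∀ μ x y, b ((f - algebraMap K (End K V) μ) x) y =
      b x ((f - algebraMap K (End K V) μ) y) := by
    intro μ x y
    simp [hf, Module.algebraMap_end_apply]
  have semisimple : ∀ μ (k : ℕ) x, ((f - algebraMap K (End K V) μ) ^ k) x = 0 →
      (f - algebraMap K (End K V) μ) x = 0 := by
    intro μ k
    induction k with
    | zero => intro x hx; simp_all
    | succ k ih =>
      intro x hx
      rw [pow_succ, Module.End.mul_apply] at hx
      have h2 := ih _ hx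
      refine eq_zero μ _ ?_ ?_
      · rw [LinearMap.sub_apply, Module.algebraMap_end_apply] at h2
        exact sub_eq_zero.mp h2
      · rw [hf', h2, map_zero]
  choose v hv using fun μ : f.Eigenvalues ↦ HasEigenvalue.exists_hasEigenvector (f := f) (μ := μ) μ.2
  have hspan : Submodule.span K (Set.range v) = ⊤ := by
    rw [eq_top_iff, ← iSup_maxGenEigenspace_eq_top f]
    refine iSup_le fun μ w hw ↦ ?_
    obtain ⟨k, hk⟩ := (mem_maxGenEigenspace f μ w).mp hw
    have hw : f w = μ • w := by
      have := semisimple μ k w hk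
      rw [LinearMap.sub_apply, Module.algebraMap_end_apply] at this
      exact sub_eq_zero.mp this
    by_cases hw0 : w = 0
    · simp [hw0]
    have hμ : f.HasEigenvalue μ :=
      hasEigenvalue_of_hasEigenvector ⟨mem_eigenspace_iff.mpr hw, hw0⟩
    have hvμ : f.HasEigenvector μ (v ⟨μ, hμ⟩) := hv ⟨μ, hμ⟩
    have hmem : v ⟨μ, hμ⟩ ∈ Submodule.span K (Set.range v) :=
      Submodule.subset_span ⟨_, rfl⟩
    generalize v ⟨μ, hμ⟩ = u at hvμ hmem
    have hu := h μ u hvμ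
    obtain ⟨s, hs⟩ := IsAlgClosed.exists_pow_nat_eq
      (-(b (w - (b w u / b u u) • u) (w - (b w u / b u u) • u)) / b u u) (n := 2) (by norm_num)
    have hzero : w - (b w u / b u u) • u + s • u = 0 := by
      refine eq_zero μ _ ?_ ?_
      · simp only [map_add, map_sub, map_smul, hw, hvμ.apply_eq_smul]
        module
      · have hcomm := hb u w
        rw [eq_div_iff hu] at hs
        simp only [map_add, map_sub, map_smul, LinearMap.add_apply, LinearMap.sub_apply,
          LinearMap.smul_apply, smul_eq_mul, hcomm] at hs ⊢
        field_simp at hs ⊢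
        linear_combination hs
    have : w = (b w u / b u u - s) • u := by
      rw [← sub_eq_zero, ← hzero]
      module
    rw [this]
    exact Submodule.smul_mem _ _ hmem
  rw [← finrank_top K V, ← hspan]
  exact finrank_range_le_card v

end Module.End

namespace Matrix

variable {ι K : Type*} [Fintype ι] [DecidableEq ι] [Field K]

theorem toLin'_inv_mul_apply_eq_smul_iff {A B : Matrix ι ι K} (hB : IsUnit B) {c : K}
    {x : ι → K} : toLin' (B⁻¹ * A) x = c • x ↔ A *ᵥ x = c • (B *ᵥ x) := by
  have hdet := (isUnit_iff_isUnit_det B).mp hB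
  rw [toLin'_apply, ← mulVec_mulVec]
  constructor
  · intro h
    rw [← mulVec_smul, ← h, mulVec_mulVec, mul_nonsing_inv B hdet, one_mulVec]
  · intro h
    rw [h, mulVec_smul, mulVec_mulVec, nonsing_inv_mul B hdet, one_mulVec]

theorem hasEigenvalue_toLin'_inv_mul_iff {A B : Matrix ι ι K} (hB : IsUnit B) {c : K} :
    Module.End.HasEigenvalue (toLin' (B⁻¹ * A)) c ↔ (A + (-c) • B).det = 0 := by
  rw [← exists_mulVec_eq_zero_iff]
  have key : ∀ x : ι → K, (A + (-c) • B) *ᵥ x = 0 ↔ toLin' (B⁻¹ * A) x = c • x := by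
    intro x
    rw [toLin'_inv_mul_apply_eq_smul_iff hB, add_mulVec, smul_mulVec, neg_smul,
      ← sub_eq_add_neg, sub_eq_zero]
  constructor
  · intro h
    obtain ⟨x, hx⟩ := h.exists_hasEigenvector
    exact ⟨x, hx.2, (key x).mpr hx.apply_eq_smul⟩
  · rintro ⟨x, hx0, hx⟩
    exact Module.End.hasEigenvalue_of_hasEigenvector
      ⟨Module.End.mem_eigenspace_iff.mpr ((key x).mp hx), hx0⟩

theorem toBilin'_apply_comm {B : Matrix ι ι K} (hB : Bᵀ = B) (x y : ι → K) :
    toBilin' B x y = toBilin' B y x := by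
  rw [toBilin'_apply', toBilin'_apply', dotProduct_mulVec, ← mulVec_transpose, hB,
    dotProduct_comm]

theorem toBilin'_toLin'_inv_mul_apply {A B : Matrix ι ι K} (hB : IsUnit B) (hAsymm : Aᵀ = A)
    (hBsymm : Bᵀ = B) (x y : ι → K) :
    toBilin' B (toLin' (B⁻¹ * A) x) y = toBilin' B x (toLin' (B⁻¹ * A) y) := by
  have h : ∀ x y, toBilin' B x (toLin' (B⁻¹ * A) y) = toBilin' A x y := fun x y ↦ by
    rw [toBilin'_apply', toBilin'_apply', toLin'_apply, mulVec_mulVec, ← Matrix.mul_assoc,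
      mul_nonsing_inv B ((isUnit_iff_isUnit_det B).mp hB), Matrix.one_mul]
  rw [toBilin'_apply_comm hBsymm, h, h, toBilin'_apply_comm hAsymm]

/-- Two quadrics are transversal iff no eigenvector of the pencil is isotropic. -/
theorem linearIndependent_mulVec_iff_hasEigenvector {A B : Matrix ι ι K} (hB : IsUnit B) :
    (∀ x : ι → K, x ≠ 0 → x ⬝ᵥ (A *ᵥ x) = 0 → x ⬝ᵥ (B *ᵥ x) = 0 →
        LinearIndependent K ![A *ᵥ x, B *ᵥ x]) ↔
      ∀ c x, Module.End.HasEigenvector (toLin' (B⁻¹ * A)) c x → toBilin' B x x ≠ 0 := by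
  constructor
  · intro h c x hx h0
    have hAx := (toLin'_inv_mul_apply_eq_smul_iff hB).mp hx.apply_eq_smul
    rw [toBilin'_apply'] at h0
    have hli := h x hx.2 (by rw [hAx, dotProduct_smul, h0, smul_zero]) h0
    rw [LinearIndependent.pair_iff] at hli
    have := (hli 1 (-c) (by rw [hAx]; module)).1
    exact one_ne_zero this
  · intro h x hx _ hxB
    have hBx : B *ᵥ x ≠ 0 := fun h0 ↦ hx <| by
      rw [← mulVec_zero B] at h0
      exact mulVec_injective_of_isUnit hB h0
    rw [← LinearIndependent.pair_symm_iff, LinearIndependent.pair_iff' hBx]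
    intro c hc
    refine h c x ⟨Module.End.mem_eigenspace_iff.mpr
      ((toLin'_inv_mul_apply_eq_smul_iff hB).mpr hc.symm), hx⟩ ?_
    rwa [toBilin'_apply']

end Matrix

/-- For invertible symmetric complex matrices `A`, `B`, the quadrics
`{xᵀAx = 0}` and `{xᵀBx = 0}` in `ℙⁿ` intersect transversally (gradients `A•x` and
`B•x` linearly independent at every common point) if and only if the degree-`n+1`
polynomial `t ↦ det (A + t • B)` has `n+1` pairwise distinct roots. -/
theorem normal_crossings_iff_pencil_has_distinct_singular_members
    (n : ℕ) (hn : 1 ≤ n)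
    (A B : Matrix (Fin (n + 1)) (Fin (n + 1)) ℂ)
    (hA : IsUnit A) (hB : IsUnit B)
    (hAsymm : Aᵀ = A) (hBsymm : Bᵀ = B) :
    (∀ x : Fin (n + 1) → ℂ, x ≠ 0 → x ⬝ᵥ (A *ᵥ x) = 0 → x ⬝ᵥ (B *ᵥ x) = 0 →
        LinearIndependent ℂ ![A *ᵥ x, B *ᵥ x]) ↔
      (∃ t : Fin (n + 1) → ℂ, Function.Injective t ∧ ∀ i, (A + t i • B).det = 0) := by
  rw [linearIndependent_mulVec_iff_hasEigenvector hB]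
  have hadj := toBilin'_toLin'_inv_mul_apply hB hAsymm hBsymm
  constructor
  · intro h
    have hcard := Module.End.finrank_le_card_eigenvalues_of_apply_self_ne_zero
      (toBilin'_apply_comm hBsymm) hadj h
    rw [Module.finrank_fin_fun] at hcard
    obtain ⟨e⟩ := Function.Embedding.nonempty_of_card_le
      ((Fintype.card_fin (n + 1)).trans_le hcard)
    refine ⟨fun i ↦ -(e i).1, fun i j hij ↦ e.injective (Subtype.ext (neg_injective hij)),
      fun i ↦ (hasEigenvalue_toLin'_inv_mul_iff hB).mp (e i).2⟩
  · rintro ⟨t, ht, hdet⟩ c x hx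
    refine hx.apply_self_ne_zero_of_injective (t := fun i ↦ -t i) (fun y hy ↦ ?_) hadj (by simp)
      (neg_injective.comp ht) fun i ↦ ?_
    · have hdet := ((isUnit_iff_isUnit_det B).mp hB).ne_zero
      exact (LinearMap.BilinForm.nondegenerate_toBilin'_of_det_ne_zero' B hdet).1 y
        fun z ↦ by rw [hy, LinearMap.zero_apply]
    · rw [hasEigenvalue_toLin'_inv_mul_iff hB, neg_neg]
      exact hdet i
end

section
/- Let A and B be invertible symmetric 3×3 matrices over ℂ such that the cubic polynomial t ↦ det(A + t•B) has three pairwise distinct complex roots. Then the set of points [x] in the projective plane ℙ(ℂ³) satisfying both xᵀ•A•x = 0 and xᵀ•B•x = 0 has exactly four elements (the pencil of conics generated by A and B has four distinct base points). -/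
open Matrix
open scoped LinearAlgebra.Projectivization

/-- Null vectors of distinct singular members of the pencil `A + t • B` are linearly
independent. -/
theorem linearIndependent_of_pencil_kernel {ι n K : Type*} [Fintype n] [DecidableEq n] [Field K]
    {A B : Matrix n n K} (hB : IsUnit B) {t : ι → K} (htinj : Function.Injective t)
    {v : ι → n → K} (hv0 : ∀ i, v i ≠ 0) (hv : ∀ i, A *ᵥ v i = (-t i) • (B *ᵥ v i)) :
    LinearIndependent K v := by
  refine Module.End.eigenvectors_linearIndependent' (Matrix.toLin' (B⁻¹ * A)) (fun i => -t i)
    (neg_injective.comp htinj) v fun i => ?_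
  rw [Module.End.hasEigenvector_iff, Module.End.mem_eigenspace_iff]
  refine ⟨?_, hv0 i⟩
  have hdet : IsUnit B.det := (Matrix.isUnit_iff_isUnit_det B).mp hB
  rw [Matrix.toLin'_apply, ← Matrix.mulVec_mulVec, hv i, Matrix.mulVec_smul, Matrix.mulVec_mulVec,
    Matrix.nonsing_inv_mul B hdet, Matrix.one_mulVec]

theorem dotProduct_mulVec_comm_of_transpose_eq {n K : Type*} [Fintype n] [CommSemiring K]
    {M : Matrix n n K} (hM : Mᵀ = M) (x y : n → K) : x ⬝ᵥ (M *ᵥ y) = y ⬝ᵥ (M *ᵥ x) := by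
  rw [Matrix.dotProduct_mulVec, ← Matrix.mulVec_transpose, hM, dotProduct_comm]

/-- Null vectors of distinct singular members of a symmetric pencil are conjugate. -/
theorem dotProduct_mulVec_eq_zero_of_pencil_kernel {n K : Type*} [Fintype n] [Field K]
    {A B : Matrix n n K} (hA : Aᵀ = A) (hB : Bᵀ = B) {a b : K} (hab : a ≠ b) {x y : n → K}
    (hx : A *ᵥ x = (-a) • (B *ᵥ x)) (hy : A *ᵥ y = (-b) • (B *ᵥ y)) :
    x ⬝ᵥ (B *ᵥ y) = 0 := by
  have h := dotProduct_mulVec_comm_of_transpose_eq hA x y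
  rw [hx, hy, dotProduct_smul, dotProduct_smul, dotProduct_mulVec_comm_of_transpose_eq hB y x,
    smul_eq_mul, smul_eq_mul] at h
  have h' : (a - b) * (x ⬝ᵥ (B *ᵥ y)) = 0 := by linear_combination h
  exact (mul_eq_zero.mp h').resolve_left (sub_ne_zero.mpr hab)

/-- The value of a quadratic form on a combination of conjugate vectors. -/
theorem dotProduct_mulVec_sum_of_orthogonal {ι n K : Type*} [Fintype ι] [Fintype n] [CommRing K]
    {M : Matrix n n K} {w : ι → n → K} (h : ∀ i j, i ≠ j → w i ⬝ᵥ (M *ᵥ w j) = 0) (y : ι → K) :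
    (∑ i, y i • w i) ⬝ᵥ (M *ᵥ ∑ i, y i • w i) = ∑ i, y i ^ 2 * (w i ⬝ᵥ (M *ᵥ w i)) := by
  rw [sum_dotProduct]
  refine Finset.sum_congr rfl fun i _ => ?_
  rw [Matrix.mulVec_sum, dotProduct_sum, Finset.sum_eq_single i]
  · simp only [Matrix.mulVec_smul, dotProduct_smul, smul_dotProduct, smul_eq_mul]
    ring
  · intro j _ hj
    simp [Matrix.mulVec_smul, h i j hj.symm]
  · simp

/-- A symmetric pencil with three distinct singular members can be diagonalized, with any
prescribed nonzero diagonal for `B`. -/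
theorem exists_basis_diagonalizing_pencil
    {A B : Matrix (Fin 3) (Fin 3) ℂ} (hB : IsUnit B) (hAsymm : Aᵀ = A) (hBsymm : Bᵀ = B)
    {t : Fin 3 → ℂ} (htinj : Function.Injective t) (hroots : ∀ i, (A + t i • B).det = 0)
    {s : Fin 3 → ℂ} (hs : ∀ i, s i ≠ 0) :
    ∃ w : Module.Basis (Fin 3) ℂ (Fin 3 → ℂ), ∀ y : Fin 3 → ℂ,
      (∑ i, y i • w i) ⬝ᵥ (B *ᵥ ∑ i, y i • w i) = ∑ i, y i ^ 2 * s i ∧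
      (∑ i, y i • w i) ⬝ᵥ (A *ᵥ ∑ i, y i • w i) = ∑ i, y i ^ 2 * (-t i * s i) := by
  have hker : ∀ i, ∃ v : Fin 3 → ℂ, v ≠ 0 ∧ A *ᵥ v = (-t i) • (B *ᵥ v) := fun i => by
    obtain ⟨v, hv0, hv⟩ := Matrix.exists_mulVec_eq_zero_iff.mpr (hroots i)
    refine ⟨v, hv0, ?_⟩
    rw [Matrix.add_mulVec, Matrix.smul_mulVec] at hv
    rw [neg_smul]
    exact eq_neg_of_add_eq_zero_left hv
  choose v hv0 hv using hker
  have horth : ∀ i j, i ≠ j → v i ⬝ᵥ (B *ᵥ v j) = 0 := fun i j hij =>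
    dotProduct_mulVec_eq_zero_of_pencil_kernel hAsymm hBsymm (htinj.ne hij) (hv i) (hv j)
  have hnorm : ∀ i, v i ⬝ᵥ (B *ᵥ v i) ≠ 0 := fun i hi => by
    let b := basisOfLinearIndependentOfCardEqFinrank
      (linearIndependent_of_pencil_kernel hB htinj hv0 hv) (by simp)
    have hzero : B *ᵥ v i = 0 := by
      refine dotProduct_eq_zero _ fun x => ?_
      rw [dotProduct_comm, ← b.sum_repr x, sum_dotProduct]
      refine Finset.sum_eq_zero fun j _ => ?_
      rw [smul_dotProduct, coe_basisOfLinearIndependentOfCardEqFinrank]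
      obtain rfl | hji := eq_or_ne j i
      · rw [hi, smul_zero]
      · rw [horth j i hji, smul_zero]
    refine hv0 i (Matrix.mulVec_injective_of_isUnit hB ?_)
    rw [hzero, Matrix.mulVec_zero]
  have hsqrt : ∀ i, ∃ c : ℂ, s i / (v i ⬝ᵥ (B *ᵥ v i)) = c ^ 2 := fun i => by
    obtain ⟨c, hc⟩ := IsAlgClosed.exists_pow_nat_eq (s i / (v i ⬝ᵥ (B *ᵥ v i))) two_pos
    exact ⟨c, hc.symm⟩
  choose c hc using hsqrt
  have hc0 : ∀ i, c i ≠ 0 := fun i h0 => by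
    have h := hc i
    rw [h0, zero_pow two_ne_zero] at h
    exact div_ne_zero (hs i) (hnorm i) h
  have hw0 : ∀ i, c i • v i ≠ 0 := fun i => smul_ne_zero (hc0 i) (hv0 i)
  have hw : ∀ i, A *ᵥ (c i • v i) = (-t i) • (B *ᵥ (c i • v i)) := fun i => by
    rw [Matrix.mulVec_smul, Matrix.mulVec_smul, hv i, smul_comm]
  have hBw : ∀ i j, i ≠ j → (c i • v i) ⬝ᵥ (B *ᵥ (c j • v j)) = 0 := fun i j hij => by
    simp [Matrix.mulVec_smul, horth i j hij]
  have hAw : ∀ i j, i ≠ j → (c i • v i) ⬝ᵥ (A *ᵥ (c j • v j)) = 0 := fun i j hij => by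
    rw [hw j, dotProduct_smul, hBw i j hij, smul_zero]
  have hBs : ∀ i, (c i • v i) ⬝ᵥ (B *ᵥ (c i • v i)) = s i := fun i => by
    rw [Matrix.mulVec_smul, dotProduct_smul, smul_dotProduct, smul_eq_mul, smul_eq_mul,
      ← mul_assoc, ← sq, ← hc i, div_mul_cancel₀ _ (hnorm i)]
  refine ⟨basisOfLinearIndependentOfCardEqFinrank
    (linearIndependent_of_pencil_kernel hB htinj hw0 hw) (by simp), fun y => ?_⟩
  rw [coe_basisOfLinearIndependentOfCardEqFinrank]
  refine ⟨?_, ?_⟩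
  · rw [dotProduct_mulVec_sum_of_orthogonal hBw]
    simp only [hBs]
  · rw [dotProduct_mulVec_sum_of_orthogonal hAw]
    simp only [hw, dotProduct_smul, hBs, smul_eq_mul]

/-- Coordinates of the four points `(1 : ±1 : ±1)`. -/
def signVector (e : ℤˣ × ℤˣ) : Fin 3 → ℂ := ![1, ((e.1 : ℤ) : ℂ), ((e.2 : ℤ) : ℂ)]

theorem signVector_sq (e : ℤˣ × ℤˣ) (i : Fin 3) : signVector e i ^ 2 = 1 := by
  have h : ∀ u : ℤˣ, ((u : ℤ) : ℂ) ^ 2 = 1 := fun u => by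
    rcases Int.units_eq_one_or u with rfl | rfl <;> simp
  fin_cases i <;> simp [signVector, h]

theorem exists_unit_cast_mul_eq_of_sq_eq {a b : ℂ} (h : b ^ 2 = a ^ 2) :
    ∃ u : ℤˣ, b = a * ((u : ℤ) : ℂ) := by
  rcases sq_eq_sq_iff_eq_or_eq_neg.mp h with h | h
  · exact ⟨1, by simp [h]⟩
  · exact ⟨-1, by simp [h]⟩

/-- A vector whose coordinates have equal squares is a multiple of a sign vector. -/
theorem exists_eq_smul_signVector {y : Fin 3 → ℂ} (h1 : y 1 ^ 2 = y 0 ^ 2)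
    (h2 : y 2 ^ 2 = y 0 ^ 2) : ∃ e, y = y 0 • signVector e := by
  obtain ⟨u, hu⟩ := exists_unit_cast_mul_eq_of_sq_eq h1
  obtain ⟨u', hu'⟩ := exists_unit_cast_mul_eq_of_sq_eq h2
  refine ⟨(u, u'), funext fun i => ?_⟩
  fin_cases i
  · simp [signVector]
  · simpa [signVector] using hu
  · simpa [signVector] using hu'

/-- Two diagonal conics meet exactly where the squares of the coordinates agree, once the
coordinates are scaled suitably. -/
theorem sq_eq_of_diagonal_conics {t y : Fin 3 → ℂ} (htinj : Function.Injective t)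
    (hB : ∑ i, y i ^ 2 * (t (i + 1) - t (i + 2)) = 0)
    (hA : ∑ i, y i ^ 2 * (-t i * (t (i + 1) - t (i + 2))) = 0) :
    y 1 ^ 2 = y 0 ^ 2 ∧ y 2 ^ 2 = y 0 ^ 2 := by
  have h01 : t 0 - t 1 ≠ 0 := sub_ne_zero.mpr (htinj.ne (by decide))
  have h02 : t 2 - t 0 ≠ 0 := sub_ne_zero.mpr (htinj.ne (by decide))
  have h12 : t 1 - t 2 ≠ 0 := sub_ne_zero.mpr (htinj.ne (by decide))
  simp only [Fin.sum_univ_three, zero_add, Fin.reduceAdd] at hA hB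
  refine ⟨mul_left_cancel₀ (mul_ne_zero h02 h12) ?_, mul_left_cancel₀ (mul_ne_zero h01 h12) ?_⟩
  · linear_combination (-1 : ℂ) * hA - t 2 * hB
  · linear_combination hA + t 1 * hB

/-- If `A`, `B` are invertible symmetric `3×3` complex matrices such that
the cubic `t ↦ det (A + t • B)` has three pairwise distinct roots, then the pencil of
conics generated by `A` and `B` has exactly four distinct base points in `ℙ(ℂ³)`. -/
theorem pencil_of_conics_has_four_base_points
    (A B : Matrix (Fin 3) (Fin 3) ℂ)
    (hA : IsUnit A) (hB : IsUnit B)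
    (hAsymm : Aᵀ = A) (hBsymm : Bᵀ = B)
    (t : Fin 3 → ℂ) (htinj : Function.Injective t)
    (hroots : ∀ i, (A + t i • B).det = 0) :
    {p : ℙ ℂ (Fin 3 → ℂ) |
        p.rep ⬝ᵥ (A *ᵥ p.rep) = 0 ∧ p.rep ⬝ᵥ (B *ᵥ p.rep) = 0}.ncard = 4 := by
  have hs : ∀ i : Fin 3, t (i + 1) - t (i + 2) ≠ 0 := fun i =>
    sub_ne_zero.mpr (htinj.ne (by revert i; decide))
  obtain ⟨w, hw⟩ := exists_basis_diagonalizing_pencil hB hAsymm hBsymm htinj hroots hs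
  have hcoord : ∀ y z : Fin 3 → ℂ, ∑ i, y i • w i = ∑ i, z i • w i → y = z := fun y z h => by
    simpa only [← w.equivFun_symm_apply, w.equivFun.symm.injective.eq_iff] using h
  have hne : ∀ e, ∑ i, signVector e i • w i ≠ 0 := fun e h => by
    have h0 := congrFun (hcoord (signVector e) 0 (by simpa using h)) 0
    simp [signVector] at h0
  let f : ℤˣ × ℤˣ → ℙ ℂ (Fin 3 → ℂ) := fun e => Projectivization.mk ℂ _ (hne e)
  have hf : Function.Injective f := fun e e' h => by
    obtain ⟨a, ha⟩ := (Projectivization.mk_eq_mk_iff' ℂ _ _ (hne e) (hne e')).mp h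
    have hy : a • signVector e' = signVector e := hcoord _ _ (by
      rw [← ha, Finset.smul_sum]
      simp [mul_smul])
    have h0 := congrFun hy 0
    have h1 := congrFun hy 1
    have h2 := congrFun hy 2
    simp only [signVector, Pi.smul_apply, smul_eq_mul, Matrix.cons_val, mul_one] at h0 h1 h2
    rw [h0, one_mul] at h1 h2
    exact Prod.ext (Units.ext (by exact_mod_cast h1.symm)) (Units.ext (by exact_mod_cast h2.symm))
  have hrange : {p : ℙ ℂ (Fin 3 → ℂ) |
      p.rep ⬝ᵥ (A *ᵥ p.rep) = 0 ∧ p.rep ⬝ᵥ (B *ᵥ p.rep) = 0} = Set.range f := by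
    ext p
    rw [Set.mem_ofPred_eq, Set.mem_range]
    constructor
    · rintro ⟨hpA, hpB⟩
      rw [← w.sum_equivFun p.rep, (hw _).2] at hpA
      rw [← w.sum_equivFun p.rep, (hw _).1] at hpB
      obtain ⟨h1, h2⟩ := sq_eq_of_diagonal_conics htinj hpB hpA
      obtain ⟨e, he⟩ := exists_eq_smul_signVector h1 h2
      have hrep : w.equivFun p.rep 0 • ∑ i, signVector e i • w i = p.rep := by
        conv_rhs => rw [← w.sum_equivFun p.rep, he]
        rw [Finset.smul_sum]
        simp [mul_smul]
      refine ⟨e, ?_⟩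
      rw [← p.mk_rep]
      exact ((Projectivization.mk_eq_mk_iff' ℂ _ _ p.rep_nonzero (hne e)).mpr ⟨_, hrep⟩).symm
    · rintro ⟨e, rfl⟩
      obtain ⟨a, ha⟩ := Projectivization.exists_smul_eq_mk_rep ℂ _ (hne e)
      rw [show (f e).rep = _ from ha.symm, Units.smul_def]
      simp only [Matrix.mulVec_smul, dotProduct_smul, smul_dotProduct, (hw _).1, (hw _).2,
        signVector_sq]
      simp only [Fin.sum_univ_three, zero_add, Fin.reduceAdd, smul_eq_mul]
      constructor <;> ring
  rw [hrange, ← Set.image_univ, Set.ncard_image_of_injective _ hf, Set.ncard_univ,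
    Nat.card_eq_fintype_card]
  rfl
end

section
/- Let n ≥ 1 and let A and B be invertible symmetric (n+1)×(n+1) matrices over ℂ such that the polynomial t ↦ det(A + t•B) has n+1 pairwise distinct roots t₀, …, tₙ. Then for each i the matrix A + tᵢ•B has rank exactly n; in particular each singular quadric in the pencil generated by A and B is a cone with a single singular point, represented by a vector spanning the one-dimensional kernel of A + tᵢ•B. -/
open Matrix

/-- Nonzero vectors in the kernels of distinct members of the pencil `A + s • B`, with `B`
invertible, are linearly independent. -/
theorem linearIndependent_of_mem_ker_pencil {K ι m : Type*} [Field K] [Fintype m] [DecidableEq m]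
    {A B : Matrix m m K} (hB : IsUnit B) {t : ι → K} (ht : Function.Injective t)
    {v : ι → m → K} (hv : ∀ i, v i ≠ 0) (hker : ∀ i, (A + t i • B) *ᵥ v i = 0) :
    LinearIndependent K v := by
  refine Module.End.eigenvectors_linearIndependent' (Matrix.toLin' (B⁻¹ * A)) (fun i => -t i)
    (neg_injective.comp ht) v fun i => ⟨Module.End.mem_eigenspace_iff.2 ?_, hv i⟩
  have hAv : A *ᵥ v i = B *ᵥ (-t i • v i) := by
    rw [mulVec_smul, neg_smul, ← smul_mulVec]
    exact eq_neg_of_add_eq_zero_left (by rw [← add_mulVec, hker i])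
  rw [toLin'_apply, ← mulVec_mulVec, hAv, mulVec_mulVec,
    nonsing_inv_mul B ((isUnit_iff_isUnit_det B).1 hB), one_mulVec]

/-- A square matrix of zero determinant over a field does not have full rank. -/
theorem rank_lt_card_of_det_eq_zero {K m : Type*} [Field K] [Fintype m] [DecidableEq m]
    {M : Matrix m m K} (hM : M.det = 0) : M.rank < Fintype.card m := by
  obtain ⟨v, hv, hMv⟩ := exists_mulVec_eq_zero_iff.2 hM
  have hpos : 0 < Module.finrank K (LinearMap.ker M.mulVecLin) :=
    Module.finrank_pos_iff_exists_ne_zero.2 ⟨⟨v, hMv⟩, fun h => hv (congrArg Subtype.val h)⟩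
  have hsum := LinearMap.finrank_range_add_finrank_ker M.mulVecLin
  rw [Module.finrank_fintype_fun_eq_card] at hsum
  unfold Matrix.rank
  omega

/-- If a pencil `A + s • B` with `B` invertible is singular at pairwise distinct parameters `t j`,
then each of those members has rank at least the number of the other parameters. -/
theorem card_le_rank_pencil_add_one {K ι m : Type*} [Field K] [Fintype ι] [DecidableEq ι]
    [Fintype m] [DecidableEq m] {A B : Matrix m m K} (hB : IsUnit B) {t : ι → K}
    (ht : Function.Injective t) (hroots : ∀ i, (A + t i • B).det = 0) (i : ι) :
    Fintype.card ι ≤ (A + t i • B).rank + 1 := by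
  choose v hv hker using fun j => exists_mulVec_eq_zero_iff.2 (hroots j)
  have hBv : LinearIndependent K fun j => B *ᵥ v j :=
    (linearIndependent_of_mem_ker_pencil hB ht hv hker).map' B.mulVecLin
      (LinearMap.ker_eq_bot.2 (mulVec_injective_iff_isUnit.2 hB))
  have hcard := finrank_span_eq_card
    (hBv.comp (Subtype.val : {j // j ≠ i} → ι) Subtype.val_injective)
  have hle : Submodule.span K (Set.range ((fun j => B *ᵥ v j) ∘ (Subtype.val : {j // j ≠ i} → ι)))
      ≤ LinearMap.range (A + t i • B).mulVecLin := by
    rw [Submodule.span_le]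
    rintro _ ⟨⟨j, hj⟩, rfl⟩
    refine ⟨(t i - t j)⁻¹ • v j, ?_⟩
    have hsplit : A + t i • B = (A + t j • B) + (t i - t j) • B := by
      rw [sub_smul]; abel
    have hne : t i - t j ≠ 0 := sub_ne_zero.2 fun h => hj (ht h).symm
    rw [mulVecLin_apply, hsplit, mulVec_smul, add_mulVec, hker j, zero_add, smul_mulVec,
      inv_smul_smul₀ hne, Function.comp_apply]
  have hmono := Submodule.finrank_mono hle
  rw [hcard, Fintype.card_subtype_compl, Fintype.card_subtype_eq] at hmono
  unfold Matrix.rank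
  omega

/-- If the pencil determinant `t ↦ det (A + t • B)` of two invertible
symmetric complex matrices has `n+1` pairwise distinct roots `t₀, …, tₙ`, then each
singular member `A + tᵢ • B` of the pencil has rank exactly `n` (it is a cone with a
single singular point). -/
theorem singular_members_of_pencil_have_rank_n
    (n : ℕ) (hn : 1 ≤ n)
    (A B : Matrix (Fin (n + 1)) (Fin (n + 1)) ℂ)
    (hA : IsUnit A) (hB : IsUnit B)
    (hAsymm : Aᵀ = A) (hBsymm : Bᵀ = B)
    (t : Fin (n + 1) → ℂ) (htinj : Function.Injective t)
    (hroots : ∀ i, (A + t i • B).det = 0) :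
    ∀ i, (A + t i • B).rank = n := by
  intro i
  have hle := card_le_rank_pencil_add_one hB htinj hroots i
  have hlt := rank_lt_card_of_det_eq_zero (hroots i)
  rw [Fintype.card_fin] at hle hlt
  omega
end

section
/- For every natural number n, the identity Σ_{h=0}^{n} C(n+1, h) • (−1)^h • 2^{n−h} • (n−h+1) = n+1 holds, where C(n+1, h) denotes the binomial coefficient. -/
/-- For every `n : ℕ`,
`Σ_{h=0}^{n} C(n+1, h) (−1)^h 2^{n−h} (n−h+1) = n+1`.
This computes the `n`-th Chern class of the logarithmic bundle of a pair of quadrics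
in `ℙⁿ`, the coefficient of `tⁿ` in `(1−t)^{n+1}/(1−2t)²`. -/
theorem chern_class_sum_identity (n : ℕ) :
    ∑ h ∈ Finset.range (n + 1),
      ((n + 1).choose h : ℤ) * (-1) ^ h * 2 ^ (n - h) * ((n : ℤ) - (h : ℤ) + 1)
      = (n : ℤ) + 1 := by
  have absorb : ∀ h ∈ Finset.range (n + 1),
      ((n + 1).choose h : ℤ) * (-1) ^ h * 2 ^ (n - h) * ((n : ℤ) - (h : ℤ) + 1)
        = ((n : ℤ) + 1) * ((-1) ^ h * 2 ^ (n - h) * (n.choose h : ℤ)) := by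
    intro h hh
    have hle : h ≤ n + 1 := (Finset.mem_range.mp hh).le
    have key : (n.choose h : ℤ) * (n + 1) = (n + 1).choose h * (n + 1 - h) := by
      have := Nat.choose_mul_succ_eq n h
      zify [hle] at this
      exact this
    linear_combination -((-1) ^ h * 2 ^ (n - h)) * key
  rw [Finset.sum_congr rfl absorb, ← Finset.mul_sum, ← add_pow]
  norm_num
end

section
/- Let a, b, c, d be nonzero complex numbers with 1 + a + b = 0, 1 + c + d = 0, a ≠ c and b ≠ d. Then the 6×7 complex matrix 𝒩₀ with rows (1, 0, 1, 0, a+b, 0, 1), (a, 1, 1+b, 1, a, a+b, 0), (0, a, 0, 1+b, 0, a, a), (1, 0, 1, 0, c+d, 0, 0), (c, 1, 1+d, 1, c, c+d, 0), (0, c, 0, 1+d, 0, c, 0) has rank exactly 5 (in particular it does not have maximal rank 6). -/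
open Matrix

/-- The `6×7` matrix `𝒩₀` arising from the restriction of the dual of the
resolution of the logarithmic bundle of a pair of conics to a jumping line has rank
exactly `5` (in particular it does not have maximal rank `6`), whenever the nonzero
parameters satisfy `1 + a + b = 0`, `1 + c + d = 0`, `a ≠ c`, `b ≠ d`. -/
theorem jumping_line_matrix_has_rank_five
    (a b c d : ℂ) (ha : a ≠ 0) (hb : b ≠ 0) (hc : c ≠ 0) (hd : d ≠ 0)
    (hab : 1 + a + b = 0) (hcd : 1 + c + d = 0)
    (hac : a ≠ c) (hbd : b ≠ d) :
    (Matrix.of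
      ![![1, 0, 1, 0, a + b, 0, 1],
        ![a, 1, 1 + b, 1, a, a + b, 0],
        ![0, a, 0, 1 + b, 0, a, a],
        ![1, 0, 1, 0, c + d, 0, 0],
        ![c, 1, 1 + d, 1, c, c + d, 0],
        ![0, c, 0, 1 + d, 0, c, 0]] : Matrix (Fin 6) (Fin 7) ℂ).rank = 5 := by
  obtain rfl : b = -1 - a := by linear_combination hab
  obtain rfl : d = -1 - c := by linear_combination hcd
  have hac' : a - c ≠ 0 := sub_ne_zero.mpr hac
  let A : Matrix (Fin 6) (Fin 5) ℂ := !![1, 0, 0, 0, 1;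
    0, a, 0, 1, 0;
    0, 0, a, 0, a;
    1, 0, 0, 0, 0;
    0, c, 0, 1, 0;
    0, 0, c, 0, 0]
  let B : Matrix (Fin 5) (Fin 7) ℂ := !![1, 0, 1, 0, -1, 0, 0;
    1, 0, -1, 0, 1, 0, 0;
    0, 1, 0, -1, 0, 1, 0;
    0, 1, 0, 1, 0, -1, 0;
    0, 0, 0, 0, 0, 0, 1]
  let L : Matrix (Fin 5) (Fin 6) ℂ := !![0, 0, 0, 1, 0, 0;
    0, 1 / (a - c), 0, 0, -1 / (a - c), 0;
    0, 0, 0, 0, 0, 1 / c;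
    0, -c / (a - c), 0, 0, a / (a - c), 0;
    1, 0, 0, -1, 0, 0]
  let R : Matrix (Fin 7) (Fin 5) ℂ := !![1 / 2, 1 / 2, 0, 0, 0;
    0, 0, 1 / 2, 1 / 2, 0;
    1 / 2, -1 / 2, 0, 0, 0;
    0, 0, -1 / 2, 1 / 2, 0;
    0, 0, 0, 0, 0;
    0, 0, 0, 0, 0;
    0, 0, 0, 0, 1]
  have hLA : L * A = 1 := by
    ext i j
    fin_cases i <;> fin_cases j <;>
      simp [L, A, Matrix.mul_apply, Fin.sum_univ_succ, hc] <;> field_simp <;> ring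
  have hBR : B * R = 1 := by
    ext i j
    fin_cases i <;> fin_cases j <;>
      simp [B, R, Matrix.mul_apply, Fin.sum_univ_succ] <;> norm_num
  have hM : (Matrix.of
      ![![1, 0, 1, 0, a + (-1 - a), 0, 1],
        ![a, 1, 1 + (-1 - a), 1, a, a + (-1 - a), 0],
        ![0, a, 0, 1 + (-1 - a), 0, a, a],
        ![1, 0, 1, 0, c + (-1 - c), 0, 0],
        ![c, 1, 1 + (-1 - c), 1, c, c + (-1 - c), 0],
        ![0, c, 0, 1 + (-1 - c), 0, c, 0]] : Matrix (Fin 6) (Fin 7) ℂ) = A * B := by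
    ext i j
    fin_cases i <;> fin_cases j <;>
      simp [A, B, Matrix.mul_apply, Fin.sum_univ_succ] <;> ring
  rw [hM]
  apply le_antisymm
  · exact (Matrix.rank_mul_le_left A B).trans A.rank_le_width
  · have hone : L * (A * B) * R = 1 := by
      rw [← Matrix.mul_assoc L, hLA, Matrix.one_mul, hBR]
    calc 5 = (L * (A * B) * R).rank := by rw [hone, Matrix.rank_one, Fintype.card_fin]
      _ ≤ (L * (A * B)).rank := Matrix.rank_mul_le_left _ _
      _ ≤ (A * B).rank := Matrix.rank_mul_le_right _ _
end
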